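/- Let 𝕜 be a nontrivially normed field, E and F normed 𝕜-vector spaces, U ⊆ E open, x ∈ U, and f : U → F a continuous map having a Fréchet derivative L : E →L[𝕜] F at x. Then f is feebly differentiable at x with derivative L: the map sending (y, t) to (f(x + t•y) − f(x))/t for t ≠ 0 and to L(y) for t = 0 is continuous on the set {(y, t) ∈ E × 𝕜 : t ≠ 0 ∧ x + t•y ∈ U} ∪ (E × {0}). -/

import Mathlib

open scoped Classical

/-- If `f` has Fréchet derivative `L` at `x`, then the slope map
`(y, t) ↦ t⁻¹ • (f (x + t • y) - f x)`,
extended by `L y` at `t = 0`, is continuous at every point `(y, 0)`. -/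
theorem continuousAt_ite_smul_slope
    {𝕜 : Type*} [NontriviallyNormedField 𝕜]
    {E : Type*} [NormedAddCommGroup E] [NormedSpace 𝕜 E]
    {F : Type*} [NormedAddCommGroup F] [NormedSpace 𝕜 F]
    {f : E → F} {x : E} {L : E →L[𝕜] F} (hL : HasFDerivAt f L x) (y : E) :
    ContinuousAt
      (fun p : E × 𝕜 => if p.2 = 0 then L p.1 else p.2⁻¹ • (f (x + p.2 • p.1) - f x))
      (y, 0) := by
  have hmap : Filter.Tendsto (fun p : E × 𝕜 => x + p.2 • p.1) (nhds (y, 0)) (nhds x) := by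
    have h : Continuous fun p : E × 𝕜 => x + p.2 • p.1 := by fun_prop
    simpa using h.tendsto (y, 0)
  have hbig : (fun p : E × 𝕜 => x + p.2 • p.1 - x) =O[nhds (y, 0)] fun p => p.2 := by
    have h := (Asymptotics.isBigO_refl (fun p : E × 𝕜 => p.2) (nhds (y, 0))).smul
      ((continuousAt_fst (p := (y, (0 : 𝕜)))).tendsto.isBigO_one 𝕜)
    simpa using h
  have hrem := ((hL.isLittleO.comp_tendsto hmap).trans_isBigO hbig).tendsto_inv_smul_nhds_zero
  have hlin : Filter.Tendsto (fun p : E × 𝕜 => L p.1) (nhds (y, 0)) (nhds (L y)) :=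
    (L.continuous.comp continuous_fst).tendsto (y, 0)
  have hsum := hlin.add hrem
  rw [add_zero] at hsum
  simp only [ContinuousAt, if_true]
  refine hsum.congr fun p => ?_
  by_cases hp : p.2 = 0
  · simp [hp]
  · simp [hp, smul_sub]

/-- **Total differentiability implies feeble differentiability.**
If `f : U → F` is continuous on the open set `U` and has Fréchet derivative `L` at `x ∈ U`,
then `f` is feebly differentiable at `x`: the map sending `(y, t)` to
`(f (x + t • y) - f x) / t` for `t ≠ 0` and to `L y` for `t = 0` is continuous on
`{(y, t) | t ≠ 0 ∧ x + t • y ∈ U} ∪ (E × {0})`. -/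
theorem hasFDerivAt_feebly_differentiable
    {𝕜 : Type*} [NontriviallyNormedField 𝕜]
    {E : Type*} [NormedAddCommGroup E] [NormedSpace 𝕜 E]
    {F : Type*} [NormedAddCommGroup F] [NormedSpace 𝕜 F]
    {U : Set E} (hU : IsOpen U) {f : E → F} (hf : ContinuousOn f U)
    {x : E} (hx : x ∈ U) {L : E →L[𝕜] F} (hL : HasFDerivAt f L x) :
    ContinuousOn
      (fun p : E × 𝕜 => if p.2 = 0 then L p.1 else p.2⁻¹ • (f (x + p.2 • p.1) - f x))
      ({p : E × 𝕜 | p.2 ≠ 0 ∧ x + p.2 • p.1 ∈ U} ∪ {p : E × 𝕜 | p.2 = 0}) := by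
  rintro ⟨y, t⟩ hp
  refine ContinuousAt.continuousWithinAt ?_
  have hmap : Continuous fun p : E × 𝕜 => x + p.2 • p.1 := by fun_prop
  by_cases ht : t = 0
  · subst ht
    exact continuousAt_ite_smul_slope hL y
  · have hmem : x + t • y ∈ U := by
      rcases hp with hp | hp
      · exact hp.2
      · exact absurd hp ht
    have hf' : ContinuousAt (fun p : E × 𝕜 => f (x + p.2 • p.1)) (y, t) :=
      ContinuousAt.comp (f := fun p : E × 𝕜 => x + p.2 • p.1)
        (hf.continuousAt (hU.mem_nhds hmem)) hmap.continuousAt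
    have hslope : ContinuousAt
        (fun p : E × 𝕜 => p.2⁻¹ • (f (x + p.2 • p.1) - f x)) (y, t) :=
      (continuousAt_snd.inv₀ ht).smul (hf'.sub continuousAt_const)
    refine hslope.congr ?_
    filter_upwards [continuousAt_snd.eventually_ne ht] with p hp2
    exact (if_neg hp2).symm
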